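/- Let p ≥ 5 be a prime. Then there exists an extraspecial p-group G of order p^5 and exponent p^2 admitting an automorphism α of order p such that the semidirect product P = G ⋊ ⟨α⟩ satisfies P'' ≠ 1; consequently P is a group of order p^6 with derived length exactly 3. -/

import Mathlib

/-- A finite group `G` is an extraspecial `p`-group if its center, derived subgroup
and Frattini subgroup all coincide and have order `p`. -/
def IsExtraspecial (p : ℕ) (G : Type*) [Group G] : Prop :=
  IsPGroup p G ∧ Subgroup.center G = commutator G ∧
    commutator G = frattini G ∧ Nat.card (Subgroup.center G) = p

/-- The set of character degrees of `G`: the dimensions of the simple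
finite-dimensional complex representations of `G`. -/
def charDegrees (G : Type) [Group G] : Set ℕ :=
  {d | ∃ V : FDRep ℂ G, CategoryTheory.Simple V ∧ Module.finrank ℂ V = d}

namespace ZMod

/-- The embedding `ZMod p → ZMod (p ^ 2)` induced by multiplication by `p`. -/
def mulEmb (p : ℕ) : ZMod p →+ ZMod (p ^ 2) :=
  ZMod.lift p ⟨(AddMonoidHom.mulLeft (p : ZMod (p ^ 2))).comp (Int.castAddHom (ZMod (p ^ 2))), by
    have h : ((p ^ 2 : ℕ) : ZMod (p ^ 2)) = 0 := ZMod.natCast_self _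
    simpa [sq] using h⟩

/-- Reduction modulo `p` on `ZMod (p ^ 2)`. -/
def redSq (p : ℕ) : ZMod (p ^ 2) →+* ZMod p :=
  ZMod.castHom (dvd_pow_self p two_ne_zero) (ZMod p)

theorem mulEmb_intCast (p : ℕ) (m : ℤ) : mulEmb p m = (p : ZMod (p ^ 2)) * m :=
  ZMod.lift_coe _ _ _

@[simp]
theorem redSq_mulEmb (p : ℕ) (c : ZMod p) : redSq p (mulEmb p c) = 0 := by
  obtain ⟨m, rfl⟩ := ZMod.intCast_surjective c
  simp [mulEmb_intCast]

theorem redSq_surjective (p : ℕ) : Function.Surjective (redSq p) :=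
  ZMod.castHom_surjective _

theorem mulEmb_injective (p : ℕ) [NeZero p] : Function.Injective (mulEmb p) := by
  refine (injective_iff_map_eq_zero _).2 fun c hc => ?_
  obtain ⟨m, rfl⟩ := ZMod.intCast_surjective c
  rw [mulEmb_intCast] at hc
  have h : (((p : ℤ) * m : ℤ) : ZMod (p ^ 2)) = 0 := by simpa using hc
  rw [ZMod.intCast_zmod_eq_zero_iff_dvd] at h
  rw [ZMod.intCast_zmod_eq_zero_iff_dvd]
  rw [Nat.cast_pow, sq] at h
  exact Int.dvd_of_mul_dvd_mul_left (by exact_mod_cast NeZero.ne p) h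

theorem exists_mulEmb_eq_of_redSq_eq_zero (p : ℕ) (a : ZMod (p ^ 2)) (ha : redSq p a = 0) :
    ∃ c, mulEmb p c = a := by
  obtain ⟨m, rfl⟩ := ZMod.intCast_surjective a
  rw [map_intCast, ZMod.intCast_zmod_eq_zero_iff_dvd] at ha
  obtain ⟨k, rfl⟩ := ha
  exact ⟨k, by simp [mulEmb_intCast]⟩

end ZMod

open ZMod (mulEmb redSq)
open scoped commutatorElement

/-- The set `ZMod (p ^ 2) × (ZMod p) ^ 3`, which carries the extraspecial group structure below. An
element is read as a binary cubic form with coefficients `(a mod p, x, y, z)` together with a lift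
of its leading coefficient. -/
@[ext]
structure CubicGroup (p : ℕ) where
  a : ZMod (p ^ 2)
  x : ZMod p
  y : ZMod p
  z : ZMod p

namespace CubicGroup

variable {p : ℕ}

/-- The invariant alternating form on binary cubics. -/
def form (g h : CubicGroup p) : ZMod p :=
  redSq p g.a * h.z - 3 * g.x * h.y + 3 * g.y * h.x - g.z * redSq p h.a

instance : Mul (CubicGroup p) :=
  ⟨fun g h => ⟨g.a + h.a + mulEmb p (form g h), g.x + h.x, g.y + h.y, g.z + h.z⟩⟩

instance : One (CubicGroup p) := ⟨⟨0, 0, 0, 0⟩⟩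

instance : Inv (CubicGroup p) := ⟨fun g => ⟨-g.a, -g.x, -g.y, -g.z⟩⟩

@[simp] theorem mul_a (g h : CubicGroup p) : (g * h).a = g.a + h.a + mulEmb p (form g h) := rfl
@[simp] theorem mul_x (g h : CubicGroup p) : (g * h).x = g.x + h.x := rfl
@[simp] theorem mul_y (g h : CubicGroup p) : (g * h).y = g.y + h.y := rfl
@[simp] theorem mul_z (g h : CubicGroup p) : (g * h).z = g.z + h.z := rfl
@[simp] theorem one_a : (1 : CubicGroup p).a = 0 := rfl
@[simp] theorem one_x : (1 : CubicGroup p).x = 0 := rfl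
@[simp] theorem one_y : (1 : CubicGroup p).y = 0 := rfl
@[simp] theorem one_z : (1 : CubicGroup p).z = 0 := rfl
@[simp] theorem inv_a (g : CubicGroup p) : g⁻¹.a = -g.a := rfl
@[simp] theorem inv_x (g : CubicGroup p) : g⁻¹.x = -g.x := rfl
@[simp] theorem inv_y (g : CubicGroup p) : g⁻¹.y = -g.y := rfl
@[simp] theorem inv_z (g : CubicGroup p) : g⁻¹.z = -g.z := rfl

theorem form_mul_left (g h k : CubicGroup p) : form (g * h) k = form g k + form h k := by
  simp [form]; ring

theorem form_mul_right (g h k : CubicGroup p) : form g (h * k) = form g h + form g k := by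
  simp [form]; ring

theorem form_swap (g h : CubicGroup p) : form h g = -form g h := by
  simp [form]; ring

instance : Group (CubicGroup p) :=
  Group.ofLeftAxioms
    (fun g h k => by
      ext
      · simp only [mul_a, form_mul_left, form_mul_right, map_add]; ring
      all_goals simp [add_assoc])
    (fun g => by ext <;> simp [form])
    (fun g => by
      have h : form g⁻¹ g = 0 := by simp [form]; ring
      ext <;> simp [h])

/-- The underlying set as a product. -/
def equivProd : CubicGroup p ≃ ZMod (p ^ 2) × ZMod p × ZMod p × ZMod p where
  toFun g := (g.a, g.x, g.y, g.z)
  invFun t := ⟨t.1, t.2.1, t.2.2.1, t.2.2.2⟩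
  left_inv _ := rfl
  right_inv _ := rfl

instance [NeZero p] : Finite (CubicGroup p) := Finite.of_equiv _ equivProd.symm

theorem natCard_eq : Nat.card (CubicGroup p) = p ^ 5 := by
  rw [Nat.card_congr equivProd]
  simp only [Nat.card_prod, Nat.card_zmod]
  ring

theorem pow_eq (g : CubicGroup p) (n : ℕ) : g ^ n = ⟨n * g.a, n * g.x, n * g.y, n * g.z⟩ := by
  induction n with
  | zero => ext <;> simp
  | succ n ih =>
    have h : form (⟨n * g.a, n * g.x, n * g.y, n * g.z⟩ : CubicGroup p) g = 0 := by simp [form]; ring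
    rw [pow_succ, ih]
    ext <;> simp [h, add_mul]

theorem pow_prime_sq (g : CubicGroup p) : g ^ p ^ 2 = 1 := by
  rw [pow_eq]
  ext <;> simp

theorem orderOf_generator (hp : p.Prime) : orderOf (⟨1, 0, 0, 0⟩ : CubicGroup p) = p ^ 2 := by
  have : Fact p.Prime := ⟨hp⟩
  refine orderOf_eq_prime_pow (n := 1) (fun h => ?_) (pow_prime_sq _)
  rw [pow_eq] at h
  have h := congrArg CubicGroup.a h
  simp only [pow_one, mul_one, one_a, ZMod.natCast_eq_zero_iff] at h
  have := Nat.le_of_dvd hp.pos h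
  nlinarith [hp.two_le]

/-- The embedding of `ZMod p` as the center. -/
def central (p : ℕ) : Multiplicative (ZMod p) →* CubicGroup p where
  toFun c := ⟨mulEmb p c.toAdd, 0, 0, 0⟩
  map_one' := by ext <;> simp
  map_mul' _ _ := by ext <;> simp [form]

theorem central_apply (c : Multiplicative (ZMod p)) :
    central p c = ⟨mulEmb p c.toAdd, 0, 0, 0⟩ := rfl

theorem central_injective [NeZero p] : Function.Injective (central p) := fun _ _ h =>
  Multiplicative.toAdd.injective (ZMod.mulEmb_injective p (congrArg CubicGroup.a h))

theorem commutatorElement_eq (g h : CubicGroup p) :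
    ⁅g, h⁆ = central p (Multiplicative.ofAdd (2 * form g h)) := by
  rw [commutatorElement_def, mul_assoc, ← mul_inv_rev, mul_inv_eq_iff_eq_mul]
  have hz : ∀ k : CubicGroup p, form (central p (Multiplicative.ofAdd (2 * form g h))) k = 0 :=
    fun k => by simp [form, central_apply]
  ext
  · rw [mul_a, mul_a, hz, mul_a, form_swap g h, central_apply]
    simp only [toAdd_ofAdd, two_mul, map_add, map_neg, map_zero]
    ring
  all_goals simp [central_apply, add_comm]

/-- The `a`-coordinate modulo `p` as a homomorphism. -/
def coordA (p : ℕ) : CubicGroup p →* Multiplicative (ZMod p) where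
  toFun g := Multiplicative.ofAdd (redSq p g.a)
  map_one' := by simp
  map_mul' g h := by simp

/-- The `x`-coordinate as a homomorphism. -/
def coordX (p : ℕ) : CubicGroup p →* Multiplicative (ZMod p) where
  toFun g := Multiplicative.ofAdd g.x
  map_one' := rfl
  map_mul' _ _ := rfl

/-- The `y`-coordinate as a homomorphism. -/
def coordY (p : ℕ) : CubicGroup p →* Multiplicative (ZMod p) where
  toFun g := Multiplicative.ofAdd g.y
  map_one' := rfl
  map_mul' _ _ := rfl

/-- The `z`-coordinate as a homomorphism. -/
def coordZ (p : ℕ) : CubicGroup p →* Multiplicative (ZMod p) where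
  toFun g := Multiplicative.ofAdd g.z
  map_one' := rfl
  map_mul' _ _ := rfl

theorem mem_range_central_iff (g : CubicGroup p) :
    g ∈ (central p).range ↔ redSq p g.a = 0 ∧ g.x = 0 ∧ g.y = 0 ∧ g.z = 0 := by
  constructor
  · rintro ⟨c, rfl⟩
    simp [central_apply]
  · rintro ⟨ha, hx, hy, hz⟩
    obtain ⟨c, hc⟩ := ZMod.exists_mulEmb_eq_of_redSq_eq_zero p g.a ha
    exact ⟨Multiplicative.ofAdd c, by ext <;> simp [central_apply, hc, hx, hy, hz]⟩

theorem two_ne_zero_zmod (hp5 : 5 ≤ p) : (2 : ZMod p) ≠ 0 := by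
  intro h
  have h : ((2 : ℕ) : ZMod p) = 0 := by exact_mod_cast h
  have := Nat.le_of_dvd two_pos ((ZMod.natCast_eq_zero_iff _ _).1 h)
  omega

theorem three_ne_zero_zmod (hp5 : 5 ≤ p) : (3 : ZMod p) ≠ 0 := by
  intro h
  have h : ((3 : ℕ) : ZMod p) = 0 := by exact_mod_cast h
  have := Nat.le_of_dvd three_pos ((ZMod.natCast_eq_zero_iff _ _).1 h)
  omega

theorem center_eq (hp : p.Prime) (hp5 : 5 ≤ p) :
    Subgroup.center (CubicGroup p) = (central p).range := by
  have : Fact p.Prime := ⟨hp⟩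
  have h2 := two_ne_zero_zmod hp5
  have h3 := three_ne_zero_zmod hp5
  ext g
  rw [Subgroup.mem_center_iff, mem_range_central_iff]
  constructor
  · intro hg
    have key : ∀ h : CubicGroup p, form h g = 0 := fun h => by
      have := commutatorElement_eq h g
      rw [commutatorElement_eq_one_iff_mul_comm.2 (hg h), eq_comm,
        map_eq_one_iff _ central_injective, ofAdd_eq_one] at this
      exact (mul_eq_zero.1 this).resolve_left h2
    have k0 := key ⟨1, 0, 0, 0⟩
    have k1 := key ⟨0, 1, 0, 0⟩
    have k2 := key ⟨0, 0, 1, 0⟩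
    have k3 := key ⟨0, 0, 0, 1⟩
    simp [form, h3] at k0 k1 k2 k3
    exact ⟨k3, k2, k1, k0⟩
  · rintro ⟨ha, hx, hy, hz⟩ h
    rw [← commutatorElement_eq_one_iff_mul_comm, commutatorElement_eq]
    simp [form, ha, hx, hy, hz]

theorem commutator_eq (hp : p.Prime) (hp5 : 5 ≤ p) :
    commutator (CubicGroup p) = (central p).range := by
  have : Fact p.Prime := ⟨hp⟩
  have h2 := two_ne_zero_zmod hp5
  apply le_antisymm
  · rw [commutator_def, Subgroup.commutator_le]
    intro g _ h _
    rw [commutatorElement_eq]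
    exact ⟨_, rfl⟩
  · rintro _ ⟨c, rfl⟩
    have hc : c = Multiplicative.ofAdd
        (2 * form (⟨1, 0, 0, 0⟩ : CubicGroup p) ⟨0, 0, 0, c.toAdd / 2⟩) := by
      simp [form, mul_div_cancel₀ _ h2]
    rw [hc, ← commutatorElement_eq]
    exact Subgroup.commutator_mem_commutator (Subgroup.mem_top _) (Subgroup.mem_top _)

end CubicGroup

/-- In any group, the center meets the derived subgroup inside the Frattini subgroup. -/
theorem center_inf_commutator_le_frattini (G : Type*) [Group G] :
    Subgroup.center G ⊓ commutator G ≤ frattini G := by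
  simp only [frattini, Order.radical, le_iInf_iff]
  intro M hM
  by_contra hle
  have hZ : ¬ Subgroup.center G ≤ M := fun h => hle (inf_le_left.trans h)
  have hsup : M ⊔ Subgroup.center G = ⊤ := hM.2 _ (left_lt_sup.2 hZ)
  refine hle (inf_le_right.trans ?_)
  rw [commutator_def, Subgroup.commutator_le]
  intro g _ h _
  obtain ⟨m, hm, z, hz, rfl⟩ := Subgroup.mem_sup_of_normal_right.1
    (hsup.ge (Subgroup.mem_top g))
  obtain ⟨n, hn, w, hw, rfl⟩ := Subgroup.mem_sup_of_normal_right.1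
    (hsup.ge (Subgroup.mem_top h))
  rw [Subgroup.mem_center_iff] at hz hw
  have : ⁅m * z, n * w⁆ = ⁅m, n⁆ := by
    have h1 : m * z * (n * w) = m * n * (w * z) := by
      rw [mul_assoc m z, ← hz]; simp only [mul_assoc]
    have h2 : n * w * (m * z) = n * m * (w * z) := by
      rw [mul_assoc n, ← mul_assoc w, ← hw m]; simp only [mul_assoc]
    rw [commutatorElement_def, mul_assoc (m * z * (n * w)), ← mul_inv_rev, h1, h2]
    group
  rw [this, commutatorElement_def]
  exact M.mul_mem (M.mul_mem (M.mul_mem hm hn) (M.inv_mem hm)) (M.inv_mem hn)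

/-- The Frattini subgroup lies in the kernel of any surjection onto a group of prime order. -/
theorem frattini_le_ker_of_prime_card {G H : Type*} [Group G] [CommGroup H] {p : ℕ}
    (hp : p.Prime) (hH : Nat.card H = p) (f : G →* H) (hf : Function.Surjective f) :
    frattini G ≤ f.ker := by
  have : Fact p.Prime := ⟨hp⟩
  have : IsSimpleGroup H := isSimpleGroup_of_prime_card hH
  refine (frattini_le_comap_frattini_of_surjective hf).trans ?_
  rw [← MonoidHom.comap_bot]
  exact Subgroup.comap_mono (frattini_le_coatom isCoatom_bot)

theorem SemidirectProduct.inl_aut_mul_inv_mem_derivedSeries_one {N H : Type*} [Group N] [Group H]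
    {φ : H →* MulAut N} (h : H) (n : N) :
    (inl (φ h n * n⁻¹) : N ⋊[φ] H) ∈ derivedSeries (N ⋊[φ] H) 1 := by
  have key : (inl (φ h n * n⁻¹) : N ⋊[φ] H) = ⁅(inr h : N ⋊[φ] H), (inl n : N ⋊[φ] H)⁆ := by
    rw [commutatorElement_def, map_mul, inl_aut, map_inv, map_inv]
  rw [key, derivedSeries_one, commutator_def]
  exact Subgroup.commutator_mem_commutator (Subgroup.mem_top _) (Subgroup.mem_top _)

/-- A semidirect product by a commutative group has third derived subgroup trivial when the second
derived subgroup of the kernel is trivial. -/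
theorem SemidirectProduct.derivedSeries_three_eq_bot {N H : Type*} [Group N] [Group H]
    {φ : H →* MulAut N} (hH : ∀ a b : H, a * b = b * a) (hN : derivedSeries N 2 = ⊥) :
    derivedSeries (N ⋊[φ] H) 3 = ⊥ := by
  have h1 : derivedSeries (N ⋊[φ] H) 1 ≤ Subgroup.map inl ⊤ := by
    rw [← MonoidHom.range_eq_map, range_inl_eq_ker_rightHom, derivedSeries_succ,
      Subgroup.commutator_le]
    intro g _ h _
    rw [MonoidHom.mem_ker, map_commutatorElement, commutatorElement_eq_one_iff_mul_comm]
    exact hH _ _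
  have h2 : derivedSeries (N ⋊[φ] H) 2 ≤ Subgroup.map inl (derivedSeries N 1) :=
    Subgroup.commutator_le_map_commutator h1 h1
  have h3 : derivedSeries (N ⋊[φ] H) 3 ≤ Subgroup.map inl (derivedSeries N 2) :=
    Subgroup.commutator_le_map_commutator h2 h2
  rwa [hN, Subgroup.map_bot, le_bot_iff] at h3

namespace CubicGroup

variable {p : ℕ}

theorem frattini_eq (hp : p.Prime) (hp5 : 5 ≤ p) :
    frattini (CubicGroup p) = (central p).range := by
  apply le_antisymm
  · intro g hg
    have hcard : Nat.card (Multiplicative (ZMod p)) = p := Nat.card_zmod p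
    have ha := frattini_le_ker_of_prime_card hp hcard (coordA p) (fun c => by
      obtain ⟨a, ha⟩ := ZMod.redSq_surjective p c.toAdd
      exact ⟨⟨a, 0, 0, 0⟩, congrArg Multiplicative.ofAdd ha⟩) hg
    have hx := frattini_le_ker_of_prime_card hp hcard (coordX p)
      (fun c => ⟨⟨0, c.toAdd, 0, 0⟩, rfl⟩) hg
    have hy := frattini_le_ker_of_prime_card hp hcard (coordY p)
      (fun c => ⟨⟨0, 0, c.toAdd, 0⟩, rfl⟩) hg
    have hz := frattini_le_ker_of_prime_card hp hcard (coordZ p)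
      (fun c => ⟨⟨0, 0, 0, c.toAdd⟩, rfl⟩) hg
    exact (mem_range_central_iff g).2 ⟨ha, hx, hy, hz⟩
  · have h := center_inf_commutator_le_frattini (CubicGroup p)
    rwa [center_eq hp hp5, commutator_eq hp hp5, inf_idem] at h

theorem isExtraspecial (hp : p.Prime) (hp5 : 5 ≤ p) : IsExtraspecial p (CubicGroup p) := by
  have : Fact p.Prime := ⟨hp⟩
  refine ⟨IsPGroup.of_card natCard_eq, ?_, ?_, ?_⟩
  · rw [center_eq hp hp5, commutator_eq hp hp5]
  · rw [commutator_eq hp hp5, frattini_eq hp hp5]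
  · rw [center_eq hp hp5,
      ← Nat.card_congr (MonoidHom.ofInjective (central_injective (p := p))).toEquiv]
    exact Nat.card_zmod p

theorem derivedSeries_two_eq_bot (hp : p.Prime) (hp5 : 5 ≤ p) :
    derivedSeries (CubicGroup p) 2 = ⊥ := by
  rw [derivedSeries_succ, derivedSeries_one, Subgroup.commutator_eq_bot_iff_le_centralizer]
  nth_rewrite 1 [commutator_eq hp hp5]
  rw [← center_eq hp hp5]
  exact Subgroup.center_le_centralizer _

/-- The substitution `s ↦ s + k` on cubics. -/
def shift (k : ZMod p) (g : CubicGroup p) : CubicGroup p :=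
  ⟨g.a, g.x + k * redSq p g.a, g.y + 2 * k * g.x + k ^ 2 * redSq p g.a,
    g.z + 3 * k * g.y + 3 * k ^ 2 * g.x + k ^ 3 * redSq p g.a⟩

theorem form_shift (k : ZMod p) (g h : CubicGroup p) : form (shift k g) (shift k h) = form g h := by
  simp only [form, shift]; ring

theorem shift_mul (k : ZMod p) (g h : CubicGroup p) : shift k (g * h) = shift k g * shift k h := by
  ext
  · rw [mul_a, form_shift]; rfl
  all_goals
    simp only [shift, mul_a, mul_x, mul_y, mul_z, map_add, ZMod.redSq_mulEmb]
    ring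

theorem shift_shift (k l : ZMod p) (g : CubicGroup p) : shift k (shift l g) = shift (k + l) g := by
  ext <;> simp only [shift] <;> ring

theorem shift_zero (g : CubicGroup p) : shift 0 g = g := by
  ext <;> simp [shift]

/-- The one-parameter group of automorphisms given by translation of the variable. -/
def shiftHom (p : ℕ) : Multiplicative (ZMod p) →* MulAut (CubicGroup p) where
  toFun k :=
    { toFun := shift k.toAdd
      invFun := shift (-k.toAdd)
      left_inv := fun g => by rw [shift_shift, neg_add_cancel, shift_zero]
      right_inv := fun g => by rw [shift_shift, add_neg_cancel, shift_zero]
      map_mul' := shift_mul _ }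
  map_one' := MulEquiv.ext shift_zero
  map_mul' k l := MulEquiv.ext fun g => (shift_shift k.toAdd l.toAdd g).symm

theorem shiftHom_apply (k : Multiplicative (ZMod p)) (g : CubicGroup p) :
    shiftHom p k g = shift k.toAdd g := rfl

theorem shiftHom_injective : Function.Injective (shiftHom p) := fun k l h => by
  have h := congrArg CubicGroup.x (DFunLike.congr_fun h (⟨1, 0, 0, 0⟩ : CubicGroup p))
  simpa [shiftHom_apply, shift] using h

/-- Translation by `1`. -/
def translation (p : ℕ) : MulAut (CubicGroup p) := shiftHom p (Multiplicative.ofAdd 1)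

theorem orderOf_translation : orderOf (translation p) = p := by
  rw [translation, orderOf_injective _ shiftHom_injective, orderOf_ofAdd_eq_addOrderOf,
    ZMod.addOrderOf_one]

theorem derivedSeries_two_semidirect_ne_bot (hp : p.Prime) (hp5 : 5 ≤ p) :
    derivedSeries (CubicGroup p ⋊[(Subgroup.zpowers (translation p)).subtype]
      ↥(Subgroup.zpowers (translation p))) 2 ≠ ⊥ := by
  have : Fact p.Prime := ⟨hp⟩
  have h2 := two_ne_zero_zmod hp5
  have h3 := three_ne_zero_zmod hp5
  have hmem : ∀ g : CubicGroup p, SemidirectProduct.inl (shift 1 g * g⁻¹) ∈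
      derivedSeries (CubicGroup p ⋊[(Subgroup.zpowers (translation p)).subtype]
        ↥(Subgroup.zpowers (translation p))) 1 := fun g =>
    SemidirectProduct.inl_aut_mul_inv_mem_derivedSeries_one
      (⟨translation p, Subgroup.mem_zpowers _⟩ : Subgroup.zpowers (translation p)) g
  intro hbot
  have h := Subgroup.commutator_mem_commutator (hmem ⟨1, 0, 0, 0⟩) (hmem ⟨0, 1, 0, 0⟩)
  rw [← derivedSeries_succ, hbot, Subgroup.mem_bot, ← map_commutatorElement,
    map_eq_one_iff _ SemidirectProduct.inl_injective, commutatorElement_eq,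
    map_eq_one_iff _ central_injective, ofAdd_eq_one] at h
  simp [form, shift, h2, h3] at h

end CubicGroup

theorem exists_extraspecial_exponent_p_sq_with_aut (p : ℕ)
    (hp : p.Prime) (hp5 : 5 ≤ p) :
    ∃ (G : Type) (_ : Group G) (_ : Finite G),
      IsExtraspecial p G ∧ Nat.card G = p ^ 5 ∧
      (∀ g : G, g ^ p ^ 2 = 1) ∧ (∃ g : G, orderOf g = p ^ 2) ∧
      ∃ α : MulAut G, orderOf α = p ∧
        derivedSeries (G ⋊[(Subgroup.zpowers α).subtype] ↥(Subgroup.zpowers α)) 2 ≠ ⊥ ∧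
        Nat.card (G ⋊[(Subgroup.zpowers α).subtype] ↥(Subgroup.zpowers α)) = p ^ 6 ∧
        derivedSeries (G ⋊[(Subgroup.zpowers α).subtype] ↥(Subgroup.zpowers α)) 3 = ⊥ := by
  have : Fact p.Prime := ⟨hp⟩
  refine ⟨CubicGroup p, inferInstance, inferInstance, CubicGroup.isExtraspecial hp hp5,
    CubicGroup.natCard_eq, CubicGroup.pow_prime_sq, ⟨_, CubicGroup.orderOf_generator hp⟩,
    CubicGroup.translation p, CubicGroup.orderOf_translation,
    CubicGroup.derivedSeries_two_semidirect_ne_bot hp hp5, ?_,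
    SemidirectProduct.derivedSeries_three_eq_bot mul_comm'
      (CubicGroup.derivedSeries_two_eq_bot hp hp5)⟩
  rw [SemidirectProduct.card, CubicGroup.natCard_eq, Nat.card_zpowers,
    CubicGroup.orderOf_translation, ← pow_succ]
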